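/- arXiv:1810.08687 — 2 statements merged into one kernel-verified Lean document; each statement's English description precedes it below -/
import Mathlib

section
/- Let p, q, r, k, l be positive integers with gcd(p + q, r + q) = 1. Then the number of triples (α, β, γ) ∈ ℤ³ with 0 ≤ α < k, 0 ≤ β < k + l, 0 ≤ γ < l, and gcd(k, l, (p + q)·(β + γ) − (r + q)·(α + β)) = 1 equals (k + l)·k·l·φ(g)/g, where g = gcd(k, l). -/
/-- Summing a function of residues over `m` full periods. -/
theorem sum_Ico_zmod {g n : ℕ} [NeZero g] (h : g ∣ n) (F : ZMod g → ℚ) :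
    ∑ x ∈ Finset.Ico (0 : ℤ) (n : ℤ), F (x : ZMod g) = (n : ℚ) / g * ∑ z, F z := by
  have hg : (g : ℚ) ≠ 0 := Nat.cast_ne_zero.mpr (NeZero.ne g)
  have period : ∑ i ∈ Finset.range g, F (i : ZMod g) = ∑ z, F z :=
    Finset.sum_bij' (fun i _ => (i : ZMod g)) (fun z _ => z.val) (by simp)
      (fun z _ => Finset.mem_range.mpr (ZMod.val_lt z))
      (fun i hi => ZMod.val_cast_of_lt (Finset.mem_range.mp hi)) (by simp) (by simp)
  have periods (m : ℕ) : ∑ i ∈ Finset.range (m * g), F (i : ZMod g) = m * ∑ z, F z := by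
    induction m with
    | zero => simp
    | succ m ih =>
      rw [Nat.succ_mul, Finset.sum_range_add, ih]
      simp [period, add_mul]
  obtain ⟨m, rfl⟩ := h
  have cast : ∑ x ∈ Finset.Ico (0 : ℤ) ((g * m : ℕ) : ℤ), F (x : ZMod g) =
      ∑ i ∈ Finset.range (g * m), F (i : ZMod g) := by
    symm
    refine Finset.sum_bij' (fun i _ => (i : ℤ)) (fun x _ => x.toNat) ?_ ?_ ?_ ?_ ?_
    · intro i hi
      rw [Finset.mem_range] at hi
      exact Finset.mem_Ico.mpr ⟨by positivity, by exact_mod_cast hi⟩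
    · intro x hx
      rw [Finset.mem_Ico] at hx
      rw [Finset.mem_range]
      lia
    · simp
    · intro x hx
      exact Int.toNat_of_nonneg (Finset.mem_Ico.mp hx).1
    · simp
  rw [cast, mul_comm g m, periods]
  push_cast
  field_simp

/-- A linear form with unimodular coefficients takes every value equally often. -/
theorem sum_linear_form {R : Type*} [CommRing R] [Fintype R] {a b : R} (h : IsCoprime a b)
    (F : R → ℚ) : ∑ u, ∑ v, F (a * u - b * v) = Fintype.card R * ∑ z, F z := by
  obtain ⟨x, y, hxy⟩ := h
  let e : R × R ≃ R × R :=
    { toFun := fun w => (a * w.1 - b * w.2, y * w.1 + x * w.2)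
      invFun := fun w => (x * w.1 + b * w.2, a * w.2 - y * w.1)
      left_inv := fun w => Prod.ext (by linear_combination w.1 * hxy)
        (by linear_combination w.2 * hxy)
      right_inv := fun w => Prod.ext (by linear_combination w.1 * hxy)
        (by linear_combination w.2 * hxy) }
  rw [← Fintype.sum_prod_type' (fun u v => F (a * u - b * v)),
    show ∑ w : R × R, F (a * w.1 - b * w.2) = ∑ w : R × R, F w.1 from
      Equiv.sum_comp e (fun w => F w.1), Fintype.sum_prod_type]
  simp [Finset.mul_sum]

theorem sum_shear_form {R : Type*} [CommRing R] [Fintype R] {a b : R} (h : IsCoprime a b)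
    (F : R → ℚ) : ∑ α, ∑ β, ∑ γ, F (a * (β + γ) - b * (α + β)) =
      (Fintype.card R : ℚ) ^ 2 * ∑ z, F z := by
  have shift (β : R) : ∑ α, ∑ γ, F (a * (β + γ) - b * (α + β)) =
      Fintype.card R * ∑ z, F z := by
    rw [← sum_linear_form h, Finset.sum_comm,
      ← Equiv.sum_comp (Equiv.addLeft β) (fun u => ∑ v, F (a * u - b * v))]
    exact Finset.sum_congr rfl fun γ _ =>
      Equiv.sum_comp (Equiv.addRight β) (fun v => F (a * (β + γ) - b * v))
  rw [Finset.sum_comm]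
  simp only [shift, Finset.sum_const, Finset.card_univ, nsmul_eq_mul]
  ring

open Classical in
theorem sum_isUnit_zmod (g : ℕ) [NeZero g] :
    ∑ z : ZMod g, (if IsUnit z then (1 : ℚ) else 0) = Nat.totient g := by
  rw [Finset.sum_boole, ← ZMod.card_units_eq_totient, ← Finset.card_univ,
    ← Finset.card_map ⟨Units.val, Units.val_injective⟩]
  congr 2
  ext z
  simp only [Finset.mem_filter, Finset.mem_univ, true_and, Finset.mem_map]
  rfl

theorem count_shear_triples_diagram_D (p q r k l : ℕ) (hp : 0 < p) (hq : 0 < q) (hr : 0 < r)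
    (hk : 0 < k) (hl : 0 < l) (hpq : Nat.gcd (p + q) (r + q) = 1) :
    (((Finset.Ico (0 : ℤ) (k : ℤ) ×ˢ Finset.Ico (0 : ℤ) ((k : ℤ) + l) ×ˢ
        Finset.Ico (0 : ℤ) (l : ℤ)).filter
      (fun v => Int.gcd (Nat.gcd k l : ℤ)
        (((p : ℤ) + q) * (v.2.1 + v.2.2) - ((r : ℤ) + q) * (v.1 + v.2.1)) = 1)).card : ℚ)
    = ((k + l) * k * l * Nat.totient (Nat.gcd k l) : ℚ) / (Nat.gcd k l : ℚ) := by
  classical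
  have hgk := Nat.gcd_dvd_left k l
  have hgl := Nat.gcd_dvd_right k l
  have : NeZero (Nat.gcd k l) := ⟨(Nat.gcd_pos_of_pos_left l hk).ne'⟩
  generalize Nat.gcd k l = g at *
  have hg : (g : ℚ) ≠ 0 := Nat.cast_ne_zero.mpr (NeZero.ne g)
  have coprime : IsCoprime ((p : ZMod g) + q) ((r : ZMod g) + q) := by
    have := (Nat.isCoprime_iff_coprime.mpr hpq).map (Int.castRingHom (ZMod g))
    simpa using this
  have unit_iff (n : ℤ) : Int.gcd (g : ℤ) n = 1 ↔ IsUnit (n : ZMod g) := by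
    rw [ZMod.coe_int_isUnit_iff_isCoprime, Int.isCoprime_iff_gcd_eq_one]
  let F : ZMod g → ℚ := fun z => if IsUnit z then 1 else 0
  have key := sum_shear_form coprime F
  rw [sum_isUnit_zmod, ZMod.card] at key
  rw [← Finset.sum_boole, Finset.sum_product]
  simp only [Finset.sum_product, unit_iff]
  push_cast
  calc _ = ∑ α ∈ Finset.Ico (0 : ℤ) k, ∑ β ∈ Finset.Ico (0 : ℤ) ((k + l : ℕ) : ℤ),
        ∑ γ ∈ Finset.Ico (0 : ℤ) l,
          F (((p : ZMod g) + q) * (β + γ) - ((r : ZMod g) + q) * (α + β)) := by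
        push_cast
        rfl
    _ = (k : ℚ) / g * (((k + l : ℕ) : ℚ) / g * ((l : ℚ) / g * (g ^ 2 * Nat.totient g))) := by
        have inner (α β : ZMod g) := sum_Ico_zmod hgl
          (fun γ => F (((p : ZMod g) + q) * (β + γ) - ((r : ZMod g) + q) * (α + β)))
        have middle (α : ZMod g) := sum_Ico_zmod (dvd_add hgk hgl)
          (fun β => ∑ γ, F (((p : ZMod g) + q) * (β + γ) - ((r : ZMod g) + q) * (α + β)))
        have outer := sum_Ico_zmod hgk (fun α => ∑ β, ∑ γ,
          F (((p : ZMod g) + q) * (β + γ) - ((r : ZMod g) + q) * (α + β)))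
        simp only [inner, ← Finset.mul_sum, middle, outer, key]
        ring
    _ = _ := by
        push_cast
        field_simp
end

section
/- For every integer n ≥ 2, the sum of (k + l)·(l + m)·φ(g)/g, where g = gcd(k + l, l + m), over all quintuples (p, q, k, l, m) of positive integers with gcd(p, q) = 1 and p·(k + l) + q·(l + m) = n, equals (1/12)·(n − 2)·(n − 3)·J₂(n). -/
/-- Jordan totient function `J_k(n) = n^k * ∏_{p prime, p ∣ n} (1 - p^{-k})`, valued in `ℚ`. -/
def jordanTotient (k n : ℕ) : ℚ := (n : ℚ) ^ k * ∏ p ∈ n.primeFactors, (1 - 1 / (p : ℚ) ^ k)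

/-- Euler product expansion of `∑ μ(d) / d ^ k` over the divisors of `n`. -/
theorem prod_one_sub_inv_pow_eq_sum_moebius {n : ℕ} (hn : n ≠ 0) (k : ℕ) :
    ∏ p ∈ n.primeFactors, (1 - 1 / (p : ℚ) ^ k) =
      ∑ d ∈ n.divisors, (ArithmeticFunction.moebius d : ℚ) / (d : ℚ) ^ k := by
  let f : ArithmeticFunction ℚ := ⟨fun d => if d = 0 then 0 else 1 / (d : ℚ) ^ k, by simp⟩
  have hf_apply (d : ℕ) (hd : d ≠ 0) : f d = 1 / (d : ℚ) ^ k := by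
    change (if d = 0 then 0 else 1 / (d : ℚ) ^ k) = _
    simp [hd]
  have hf : f.IsMultiplicative := by
    refine ⟨by simp [hf_apply 1 one_ne_zero], fun {a b} _ => ?_⟩
    rcases eq_or_ne a 0 with rfl | ha
    · simp
    rcases eq_or_ne b 0 with rfl | hb
    · simp
    rw [hf_apply _ (mul_ne_zero ha hb), hf_apply a ha, hf_apply b hb]
    push_cast
    rw [mul_pow]
    field_simp
  have key := hf.prodPrimeFactors_one_sub_of_squarefree f
    (UniqueFactorizationMonoid.squarefree_radical (a := n))
  rw [Nat.primeFactors_radical] at key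
  have hsub : (UniqueFactorizationMonoid.radical n).divisors ⊆ n.divisors :=
    Nat.divisors_subset_of_dvd hn UniqueFactorizationMonoid.radical_dvd_self
  calc ∏ p ∈ n.primeFactors, (1 - 1 / (p : ℚ) ^ k)
      = ∏ p ∈ n.primeFactors, (1 - f p) := Finset.prod_congr rfl fun p hp => by
        rw [hf_apply p (Nat.prime_of_mem_primeFactors hp).ne_zero]
    _ = ∑ d ∈ (UniqueFactorizationMonoid.radical n).divisors,
          (ArithmeticFunction.moebius d : ℚ) / (d : ℚ) ^ k := by
        rw [key]
        refine Finset.sum_congr rfl fun d hd => ?_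
        rw [hf_apply d (Nat.pos_of_mem_divisors hd).ne', mul_one_div]
    _ = _ := by
        refine Finset.sum_subset hsub fun d hd hd' => ?_
        rw [ArithmeticFunction.moebius_eq_zero_of_not_squarefree]
        · simp
        · intro hsq
          apply hd'
          rw [Nat.mem_divisors]
          refine ⟨?_, UniqueFactorizationMonoid.radical_ne_zero⟩
          exact (UniqueFactorizationMonoid.dvd_radical_iff hsq.isRadical hn).2
            (Nat.dvd_of_mem_divisors hd)

theorem totient_div_self_eq_sum_moebius {n : ℕ} (hn : n ≠ 0) :
    (n.totient : ℚ) / n = ∑ d ∈ n.divisors, (ArithmeticFunction.moebius d : ℚ) / d := by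
  have h := prod_one_sub_inv_pow_eq_sum_moebius hn 1
  simp only [pow_one] at h
  rw [← h, Nat.totient_eq_mul_prod_factors]
  have : (n : ℚ) ≠ 0 := by exact_mod_cast hn
  field_simp

theorem jordanTotient_eq_sum_moebius {n : ℕ} (hn : n ≠ 0) (k : ℕ) :
    jordanTotient k n =
      ∑ d ∈ n.divisors, (ArithmeticFunction.moebius d : ℚ) * ((n / d : ℕ) : ℚ) ^ k := by
  rw [jordanTotient, prod_one_sub_inv_pow_eq_sum_moebius hn, Finset.mul_sum]
  refine Finset.sum_congr rfl fun d hd => ?_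
  have hd0 : (d : ℚ) ≠ 0 := by exact_mod_cast (Nat.pos_of_mem_divisors hd).ne'
  rw [Nat.cast_div (Nat.dvd_of_mem_divisors hd) hd0, div_pow]
  ring

theorem sum_Icc_mul_totient_gcd_div_gcd {n : ℕ} (hn : n ≠ 0) (h : ℕ → ℚ) :
    ∑ x ∈ Finset.Icc 1 n, h x * (((x.gcd n).totient : ℚ) / (x.gcd n : ℕ)) =
      ∑ d ∈ n.divisors, (ArithmeticFunction.moebius d : ℚ) / d *
        ∑ y ∈ Finset.Icc 1 (n / d), h (d * y) := by
  have step (x : ℕ) : h x * (((x.gcd n).totient : ℚ) / (x.gcd n : ℕ)) =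
      ∑ d ∈ n.divisors, if d ∣ x then (ArithmeticFunction.moebius d : ℚ) / d * h x else 0 := by
    rw [totient_div_self_eq_sum_moebius (Nat.gcd_ne_zero_right hn), ← Finset.sum_filter,
      ← Finset.sum_mul, mul_comm]
    congr 2
    ext d
    simp only [Nat.mem_divisors, Finset.mem_filter, Nat.dvd_gcd_iff]
    have := Nat.gcd_ne_zero_right (m := x) hn
    tauto
  simp_rw [step]
  rw [Finset.sum_comm]
  refine Finset.sum_congr rfl fun d hd => ?_
  have hd0 := Nat.pos_of_mem_divisors hd
  rw [← Finset.sum_filter, Finset.mul_sum]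
  symm
  refine Finset.sum_bij (fun y _ => d * y) ?_ ?_ ?_ ?_
  · intro y hy
    simp only [Finset.mem_Icc, Finset.mem_filter] at hy ⊢
    refine ⟨⟨Nat.mul_pos hd0 hy.1, ?_⟩, dvd_mul_right _ _⟩
    rw [mul_comm]
    exact (Nat.le_div_iff_mul_le hd0).1 hy.2
  · intro a _ b _ hab
    exact Nat.eq_of_mul_eq_mul_left hd0 hab
  · intro b hb
    simp only [Finset.mem_Icc, Finset.mem_filter] at hb
    obtain ⟨⟨h1, h2⟩, c, rfl⟩ := hb
    refine ⟨c, ?_, rfl⟩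
    simp only [Finset.mem_Icc]
    exact ⟨Nat.pos_of_mul_pos_left h1 , (Nat.le_div_iff_mul_le hd0).2 (by rwa [mul_comm])⟩
  · intros; rfl

theorem sum_Icc_totient_gcd_div_gcd {n : ℕ} (hn : n ≠ 0) :
    ∑ x ∈ Finset.Icc 1 n, (((x.gcd n).totient : ℚ) / (x.gcd n : ℕ)) = jordanTotient 2 n / n := by
  have h := sum_Icc_mul_totient_gcd_div_gcd hn fun _ => 1
  simp only [one_mul] at h
  rw [h, jordanTotient_eq_sum_moebius hn, Finset.sum_div]
  refine Finset.sum_congr rfl fun d hd => ?_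
  have hd0 : (d : ℚ) ≠ 0 := by exact_mod_cast (Nat.pos_of_mem_divisors hd).ne'
  have hn0 : (n : ℚ) ≠ 0 := by exact_mod_cast hn
  simp only [Finset.sum_const, Nat.card_Icc, Nat.add_sub_cancel, nsmul_eq_mul, mul_one]
  rw [Nat.cast_div (Nat.dvd_of_mem_divisors hd) hd0]
  field_simp

theorem sum_Icc_mul_sub (m : ℕ) (c : ℚ) :
    ∑ y ∈ Finset.Icc 1 m, (y : ℚ) * (c - y) =
      c * (m * (m + 1) / 2) - m * (m + 1) * (2 * m + 1) / 6 := by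
  induction m with
  | zero => simp
  | succ m ih =>
    rw [Finset.sum_Icc_succ_top (by omega), ih]
    push_cast
    ring

theorem sum_Icc_mul_sub_mul_totient_gcd_div_gcd {n : ℕ} (hn : 2 ≤ n) :
    ∑ x ∈ Finset.Icc 1 n, ((x : ℚ) * (n - x)) * (((x.gcd n).totient : ℚ) / (x.gcd n : ℕ)) =
      n / 6 * jordanTotient 2 n := by
  have hn' : n ≠ 0 := by omega
  have hmu : ∑ d ∈ n.divisors, (ArithmeticFunction.moebius d : ℚ) = 0 := by
    obtain ⟨p, hp⟩ := Nat.nonempty_primeFactors.2 (show 1 < n by omega)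
    have h := prod_one_sub_inv_pow_eq_sum_moebius hn' 0
    rw [Finset.prod_eq_zero hp (by simp)] at h
    simpa using h.symm
  rw [sum_Icc_mul_totient_gcd_div_gcd hn' fun x => (x : ℚ) * (n - x),
    jordanTotient_eq_sum_moebius hn', Finset.mul_sum,
    ← sub_zero (∑ d ∈ n.divisors, _ * (_ * _)), ← mul_zero ((n : ℚ) / 6), ← hmu, Finset.mul_sum,
    ← Finset.sum_sub_distrib]
  refine Finset.sum_congr rfl fun d hd => ?_
  have hd0 : (d : ℚ) ≠ 0 := by exact_mod_cast (Nat.pos_of_mem_divisors hd).ne'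
  obtain ⟨m, rfl⟩ := Nat.dvd_of_mem_divisors hd
  rw [Nat.mul_div_cancel_left _ (Nat.pos_of_mem_divisors hd)]
  have (y : ℕ) : ((d * y : ℕ) : ℚ) * (((d * m : ℕ) : ℚ) - ((d * y : ℕ) : ℚ)) =
      (d : ℚ) ^ 2 * ((y : ℚ) * (m - y)) := by
    push_cast
    ring
  simp_rw [this]
  rw [← Finset.mul_sum, sum_Icc_mul_sub]
  push_cast
  field_simp
  ring

theorem sum_Icc_comp_gcd {n : ℕ} (hn : n ≠ 0) (f : ℕ → ℚ) :
    ∑ x ∈ Finset.Icc 1 n, f (x.gcd n) = ∑ d ∈ n.divisors, f d * ((n / d).totient : ℚ) := by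
  have h : ∑ x ∈ Finset.Icc 1 n, f (x.gcd n) = ∑ x ∈ Finset.range n, f (n.gcd x) := by
    rw [← Finset.Ico_succ_right_eq_Icc, Finset.sum_Ico_eq_sum_range]
    simp only [Nat.succ_eq_succ, Nat.succ_eq_add_one, Nat.add_sub_cancel]
    have h1 := Finset.sum_range_succ (fun x => f (n.gcd x)) n
    rw [Finset.sum_range_succ'] at h1
    simp only [Nat.gcd_self, Nat.gcd_zero_right, add_left_inj] at h1
    rw [← h1]
    exact Finset.sum_congr rfl fun x _ => by rw [Nat.gcd_comm, add_comm]
  rw [h, ← Finset.sum_fiberwise_of_maps_to (t := n.divisors) (g := fun x => n.gcd x)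
    fun x _ => Nat.mem_divisors.2 ⟨Nat.gcd_dvd_left _ _, hn⟩]
  refine Finset.sum_congr rfl fun d hd => ?_
  rw [Nat.totient_div_of_dvd (Nat.dvd_of_mem_divisors hd),
    Finset.sum_congr rfl fun x hx => by rw [(Finset.mem_filter.1 hx).2]]
  simp [mul_comm]

theorem sum_Icc_gcd_mul_totient_gcd {n : ℕ} (hn : n ≠ 0) :
    ∑ x ∈ Finset.Icc 1 n, ((x.gcd n : ℕ) : ℚ) * ((x.gcd n).totient : ℚ) = jordanTotient 2 n := by
  have hn0 : (n : ℚ) ≠ 0 := by exact_mod_cast hn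
  have h := sum_Icc_totient_gcd_div_gcd hn
  rw [sum_Icc_comp_gcd hn fun g => (g.totient : ℚ) / g, eq_div_iff hn0, Finset.sum_mul] at h
  rw [sum_Icc_comp_gcd hn fun g => (g : ℚ) * g.totient, ← h, ← Nat.sum_div_divisors]
  refine Finset.sum_congr rfl fun d hd => ?_
  have hd0 : (d : ℚ) ≠ 0 := by exact_mod_cast (Nat.pos_of_mem_divisors hd).ne'
  rw [Nat.div_div_self (Nat.dvd_of_mem_divisors hd) hn,
    Nat.cast_div (Nat.dvd_of_mem_divisors hd) hd0]
  field_simp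

/-- The representations `n = p * x + q * y` in positive integers with `p`, `q` coprime,
as quadruples `(p, q, x, y)`. -/
def coprimeRepresentations (n : ℕ) : Finset (ℕ × ℕ × ℕ × ℕ) :=
  (Finset.Icc 1 n ×ˢ Finset.Icc 1 n ×ˢ Finset.Icc 1 n ×ˢ Finset.Icc 1 n).filter
    fun v => Nat.gcd v.1 v.2.1 = 1 ∧ v.1 * v.2.2.1 + v.2.1 * v.2.2.2 = n

theorem mem_coprimeRepresentations {n p q x y : ℕ} :
    (p, q, x, y) ∈ coprimeRepresentations n ↔
      (0 < p ∧ 0 < q ∧ 0 < x ∧ 0 < y) ∧ Nat.gcd p q = 1 ∧ p * x + q * y = n := by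
  simp only [coprimeRepresentations, Finset.mem_filter, Finset.mem_product, Finset.mem_Icc]
  constructor
  · rintro ⟨⟨⟨hp, -⟩, ⟨hq, -⟩, ⟨hx, -⟩, ⟨hy, -⟩⟩, h⟩
    exact ⟨⟨hp, hq, hx, hy⟩, h⟩
  · rintro ⟨⟨hp, hq, hx, hy⟩, h, rfl⟩
    have h1 := Nat.le_mul_of_pos_right p hx
    have h2 := Nat.le_mul_of_pos_left x hp
    have h3 := Nat.le_mul_of_pos_right q hy
    have h4 := Nat.le_mul_of_pos_left y hq
    refine ⟨⟨⟨hp, ?_⟩, ⟨hq, ?_⟩, ⟨hx, ?_⟩, ⟨hy, ?_⟩⟩, h, rfl⟩ <;> omega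

/-- The symmetry exchanging the two summands `p * x` and `q * y`. -/
theorem sum_coprimeRepresentations_swap (n : ℕ) (P : ℕ × ℕ × ℕ × ℕ → Prop) [DecidablePred P]
    (f : ℕ × ℕ × ℕ × ℕ → ℚ) :
    ∑ v ∈ (coprimeRepresentations n).filter (fun v => P (v.2.1, v.1, v.2.2.2, v.2.2.1)),
      f (v.2.1, v.1, v.2.2.2, v.2.2.1) = ∑ v ∈ (coprimeRepresentations n).filter P, f v := by
  refine Finset.sum_bij' (fun v _ => (v.2.1, v.1, v.2.2.2, v.2.2.1))
    (fun v _ => (v.2.1, v.1, v.2.2.2, v.2.2.1)) ?_ ?_ ?_ ?_ ?_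
  · rintro ⟨p, q, x, y⟩ h
    simp only [Finset.mem_filter, mem_coprimeRepresentations] at h ⊢
    rw [Nat.gcd_comm, add_comm]
    tauto
  · rintro ⟨p, q, x, y⟩ h
    simp only [Finset.mem_filter, mem_coprimeRepresentations] at h ⊢
    rw [Nat.gcd_comm, add_comm]
    tauto
  · intros; rfl
  · intros; rfl
  · intros; rfl

theorem sum_eq_sum_filter_eq_add_two_mul (n : ℕ) (f : ℕ × ℕ × ℕ × ℕ → ℚ)
    (hf : ∀ p q x y, f (q, p, y, x) = f (p, q, x, y)) (a : ℕ × ℕ × ℕ × ℕ → ℕ) :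
    ∑ v ∈ coprimeRepresentations n, f v =
      ∑ v ∈ (coprimeRepresentations n).filter
        (fun v => a v = a (v.2.1, v.1, v.2.2.2, v.2.2.1)), f v +
      2 * ∑ v ∈ (coprimeRepresentations n).filter
        (fun v => a v < a (v.2.1, v.1, v.2.2.2, v.2.2.1)), f v := by
  have hs := sum_coprimeRepresentations_swap n
    (fun v => a v < a (v.2.1, v.1, v.2.2.2, v.2.2.1)) f
  simp only [hf, Prod.mk.eta] at hs
  rw [two_mul]
  nth_rewrite 2 [← hs]
  rw [Finset.sum_filter, Finset.sum_filter, Finset.sum_filter, ← Finset.sum_add_distrib,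
    ← Finset.sum_add_distrib]
  refine Finset.sum_congr rfl fun v _ => ?_
  rcases lt_trichotomy (a v) (a (v.2.1, v.1, v.2.2.2, v.2.2.1)) with h | h | h
  · simp [h, h.ne, h.not_gt]
  · simp [h]
  · simp [h, h.ne', h.not_gt]

/-- The Euclidean step `p * x + q * y = p * (x - y) + (p + q) * y`. -/
theorem sum_filter_snd_lt_fst (n : ℕ) (f : ℕ → ℕ → ℚ) :
    ∑ v ∈ (coprimeRepresentations n).filter (fun v => v.2.2.2 < v.2.2.1),
      f (v.2.2.1 - v.2.2.2) v.2.2.2 =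
    ∑ v ∈ (coprimeRepresentations n).filter (fun v => v.1 < v.2.1), f v.2.2.1 v.2.2.2 := by
  refine Finset.sum_bij' (fun v _ => (v.1, v.1 + v.2.1, v.2.2.1 - v.2.2.2, v.2.2.2))
    (fun v _ => (v.1, v.2.1 - v.1, v.2.2.1 + v.2.2.2, v.2.2.2)) ?_ ?_ ?_ ?_ ?_
  · rintro ⟨p, q, x, y⟩ h
    simp only [Finset.mem_filter, mem_coprimeRepresentations] at h ⊢
    obtain ⟨⟨⟨hp, hq, hx, hy⟩, hg, he⟩, hlt⟩ := h
    obtain ⟨z, rfl⟩ := Nat.exists_eq_add_of_lt hlt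
    refine ⟨⟨⟨hp, by omega, by omega, hy⟩, by simpa using hg, ?_⟩, by omega⟩
    rw [show y + z + 1 - y = z + 1 by omega, ← he]
    ring
  · rintro ⟨p, q, x, y⟩ h
    simp only [Finset.mem_filter, mem_coprimeRepresentations] at h ⊢
    obtain ⟨⟨⟨hp, hq, hx, hy⟩, hg, he⟩, hlt⟩ := h
    obtain ⟨z, rfl⟩ := Nat.exists_eq_add_of_lt hlt
    rw [show p + z + 1 - p = z + 1 by omega]
    refine ⟨⟨⟨hp, by omega, by omega, hy⟩, ?_, ?_⟩, by omega⟩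
    · rw [add_assoc] at hg
      simpa using hg
    · rw [← he]
      ring
  · rintro ⟨p, q, x, y⟩ h
    simp only [Finset.mem_filter] at h
    simp only [Prod.mk.injEq, true_and, and_true]
    omega
  · rintro ⟨p, q, x, y⟩ h
    simp only [Finset.mem_filter] at h
    simp only [Prod.mk.injEq, true_and, and_true]
    omega
  · intros; rfl

theorem sum_coprimeRepresentations_eq (n : ℕ) (F f : ℕ → ℕ → ℚ)
    (hF : ∀ x y, F y x = F x y) (hf : ∀ x y, f y x = f x y)
    (hFf : ∀ x y, y < x → F x y = f x y - f (x - y) y) :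
    ∑ v ∈ coprimeRepresentations n, F v.2.2.1 v.2.2.2 =
      ∑ v ∈ (coprimeRepresentations n).filter (fun v => v.1 = v.2.1), f v.2.2.1 v.2.2.2 +
      ∑ v ∈ (coprimeRepresentations n).filter (fun v => v.2.2.1 = v.2.2.2),
        (F v.2.2.1 v.2.2.1 - f v.2.2.1 v.2.2.1) := by
  have h1 := sum_eq_sum_filter_eq_add_two_mul n (fun v => F v.2.2.1 v.2.2.2)
    (fun _ _ _ _ => hF _ _) fun v => v.2.2.2
  have h2 := sum_eq_sum_filter_eq_add_two_mul n (fun v => f v.2.2.1 v.2.2.2)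
    (fun _ _ _ _ => hf _ _) fun v => v.2.2.2
  have h3 := sum_eq_sum_filter_eq_add_two_mul n (fun v => f v.2.2.1 v.2.2.2)
    (fun _ _ _ _ => hf _ _) fun v => v.1
  have h4 := sum_filter_snd_lt_fst n f
  have h5 : ∑ v ∈ (coprimeRepresentations n).filter (fun v => v.2.2.2 < v.2.2.1),
      F v.2.2.1 v.2.2.2 =
      ∑ v ∈ (coprimeRepresentations n).filter (fun v => v.2.2.2 < v.2.2.1), f v.2.2.1 v.2.2.2 -
      ∑ v ∈ (coprimeRepresentations n).filter (fun v => v.2.2.2 < v.2.2.1),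
        f (v.2.2.1 - v.2.2.2) v.2.2.2 := by
    rw [← Finset.sum_sub_distrib]
    exact Finset.sum_congr rfl fun v hv => hFf _ _ (Finset.mem_filter.1 hv).2
  have h6 : ∑ v ∈ (coprimeRepresentations n).filter (fun v => v.2.2.1 = v.2.2.2),
      (F v.2.2.1 v.2.2.1 - f v.2.2.1 v.2.2.1) =
      ∑ v ∈ (coprimeRepresentations n).filter (fun v => v.2.2.2 = v.2.2.1), F v.2.2.1 v.2.2.2 -
      ∑ v ∈ (coprimeRepresentations n).filter (fun v => v.2.2.2 = v.2.2.1),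
        f v.2.2.1 v.2.2.2 := by
    rw [← Finset.sum_sub_distrib]
    simp only [eq_comm (a := Prod.fst (Prod.snd (Prod.snd _)))]
    exact Finset.sum_congr rfl fun v hv => by rw [(Finset.mem_filter.1 hv).2]
  simp only at h1 h2 h3
  linarith

theorem sum_filter_fst_eq_snd (n : ℕ) (f : ℕ → ℕ → ℚ) :
    ∑ v ∈ (coprimeRepresentations n).filter (fun v => v.1 = v.2.1), f v.2.2.1 v.2.2.2 =
      ∑ x ∈ Finset.Ico 1 n, f x (n - x) := by
  refine Finset.sum_bij' (fun v _ => v.2.2.1) (fun x _ => (1, 1, x, n - x)) ?_ ?_ ?_ ?_ ?_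
  · rintro ⟨p, q, x, y⟩ h
    simp only [Finset.mem_filter, mem_coprimeRepresentations] at h
    obtain ⟨⟨⟨hp, hq, hx, hy⟩, hg, he⟩, rfl⟩ := h
    rw [Nat.gcd_self] at hg
    subst hg
    simp only [Finset.mem_Ico]
    omega
  · intro x hx
    simp only [Finset.mem_filter, mem_coprimeRepresentations, Finset.mem_Ico] at hx ⊢
    refine ⟨⟨⟨one_pos, one_pos, ?_, ?_⟩, Nat.gcd_self 1, ?_⟩, trivial⟩ <;> omega
  · rintro ⟨p, q, x, y⟩ h
    simp only [Finset.mem_filter, mem_coprimeRepresentations] at h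
    obtain ⟨⟨⟨hp, hq, hx, hy⟩, hg, he⟩, rfl⟩ := h
    rw [Nat.gcd_self] at hg
    subst hg
    simp only [Prod.mk.injEq, true_and]
    omega
  · intros; rfl
  · rintro ⟨p, q, x, y⟩ h
    simp only [Finset.mem_filter, mem_coprimeRepresentations] at h
    obtain ⟨⟨⟨hp, hq, hx, hy⟩, hg, he⟩, rfl⟩ := h
    rw [Nat.gcd_self] at hg
    subst hg
    simp only
    congr 1
    omega

theorem sum_filter_coeff_eq (n : ℕ) (f : ℕ → ℚ) :
    ∑ v ∈ (coprimeRepresentations n).filter (fun v => v.2.2.1 = v.2.2.2), f v.2.2.1 =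
      ∑ a ∈ Finset.Ico 1 n, f (a.gcd n) := by
  have hgcd {p q x y : ℕ}
      (h : (p, q, x, y) ∈ (coprimeRepresentations n).filter (fun v => v.2.2.1 = v.2.2.2)) :
      (p * x).gcd n = x := by
    simp only [Finset.mem_filter, mem_coprimeRepresentations] at h
    obtain ⟨⟨-, hg, he⟩, rfl⟩ := h
    rw [← he, ← add_mul, Nat.gcd_mul_right, Nat.gcd_self_add_right, hg, one_mul]
  refine Finset.sum_bij' (fun v _ => v.1 * v.2.2.1)
    (fun a _ => (a / a.gcd n, (n - a) / a.gcd n, a.gcd n, a.gcd n)) ?_ ?_ ?_ ?_ ?_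
  · rintro ⟨p, q, x, y⟩ h
    simp only [Finset.mem_filter, mem_coprimeRepresentations] at h
    obtain ⟨⟨⟨hp, hq, hx, hy⟩, hg, he⟩, rfl⟩ := h
    have := Nat.mul_pos hp hx
    have := Nat.mul_pos hq hx
    simp only [Finset.mem_Ico]
    omega
  · intro a ha
    simp only [Finset.mem_filter, mem_coprimeRepresentations, Finset.mem_Ico] at ha ⊢
    have hpos : 0 < a.gcd n := Nat.gcd_pos_of_pos_left _ ha.1
    have h1 : a.gcd n ∣ a := Nat.gcd_dvd_left _ _
    have h2 : a.gcd n ∣ n - a := Nat.dvd_sub (Nat.gcd_dvd_right _ _) h1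
    have h3 : a.gcd (n - a) = a.gcd n := Nat.gcd_sub_self_right ha.2.le
    refine ⟨⟨⟨Nat.div_pos (Nat.le_of_dvd ha.1 h1) hpos,
      Nat.div_pos (Nat.le_of_dvd (by omega) h2) hpos, hpos, hpos⟩, ?_, ?_⟩, trivial⟩
    · rw [Nat.gcd_div h1 h2, h3, Nat.div_self hpos]
    · rw [Nat.div_mul_cancel h1, Nat.div_mul_cancel h2]
      omega
  · rintro ⟨p, q, x, y⟩ h
    have hg := hgcd h
    simp only [Finset.mem_filter, mem_coprimeRepresentations] at h
    obtain ⟨⟨⟨hp, hq, hx, hy⟩, -, he⟩, rfl⟩ := h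
    simp only [hg]
    rw [← he, Nat.add_sub_cancel_left, Nat.mul_div_cancel _ hx, Nat.mul_div_cancel _ hx]
  · intro a _
    exact Nat.div_mul_cancel (Nat.gcd_dvd_left _ _)
  · rintro ⟨p, q, x, y⟩ h
    simp only [hgcd h]

theorem sum_filter_quintuples_eq (n : ℕ) (f : ℕ → ℕ → ℚ) :
    ∑ v ∈ (Finset.Icc 1 n ×ˢ Finset.Icc 1 n ×ˢ Finset.Icc 1 n ×ˢ Finset.Icc 1 n ×ˢ
        Finset.Icc 1 n).filter
        (fun v : ℕ × ℕ × ℕ × ℕ × ℕ => Nat.gcd v.1 v.2.1 = 1 ∧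
          v.1 * (v.2.2.1 + v.2.2.2.1) + v.2.1 * (v.2.2.2.1 + v.2.2.2.2) = n),
      f (v.2.2.1 + v.2.2.2.1) (v.2.2.2.1 + v.2.2.2.2) =
    ∑ v ∈ coprimeRepresentations n,
      (((min v.2.2.1 v.2.2.2 : ℕ) : ℚ) - 1) * f v.2.2.1 v.2.2.2 := by
  have h : ∑ v ∈ coprimeRepresentations n,
      (((min v.2.2.1 v.2.2.2 : ℕ) : ℚ) - 1) * f v.2.2.1 v.2.2.2 =
      ∑ v ∈ coprimeRepresentations n, ∑ _l ∈ Finset.Ico 1 (min v.2.2.1 v.2.2.2),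
        f v.2.2.1 v.2.2.2 := by
    refine Finset.sum_congr rfl ?_
    rintro ⟨p, q, x, y⟩ hv
    rw [mem_coprimeRepresentations] at hv
    have : 1 ≤ min x y := by omega
    simp [Nat.cast_sub this]
  rw [h, Finset.sum_sigma']
  refine Finset.sum_bij'
    (fun v _ => ⟨(v.1, v.2.1, v.2.2.1 + v.2.2.2.1, v.2.2.2.1 + v.2.2.2.2), v.2.2.2.1⟩)
    (fun w _ => (w.1.1, w.1.2.1, w.1.2.2.1 - w.2, w.2, w.1.2.2.2 - w.2)) ?_ ?_ ?_ ?_ ?_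
  · rintro ⟨p, q, k, l, m⟩ hv
    simp only [Finset.mem_filter, Finset.mem_product, Finset.mem_Icc, Finset.mem_sigma,
      mem_coprimeRepresentations, Finset.mem_Ico] at hv ⊢
    refine ⟨⟨?_, hv.2⟩, ?_⟩ <;> omega
  · rintro ⟨⟨p, q, x, y⟩, l⟩ hw
    simp only [Finset.mem_sigma, Finset.mem_Ico] at hw
    have hbd := (Finset.mem_filter.1 hw.1).1
    have hrep := mem_coprimeRepresentations.1 hw.1
    simp only [Finset.mem_filter, Finset.mem_product, Finset.mem_Icc] at hbd ⊢
    rw [Nat.sub_add_cancel (by omega), Nat.add_sub_cancel' (by omega)]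
    refine ⟨?_, hrep.2⟩
    omega
  · rintro ⟨p, q, k, l, m⟩ _
    simp
  · rintro ⟨⟨p, q, x, y⟩, l⟩ hw
    simp only [Finset.mem_sigma, Finset.mem_Ico] at hw
    simp only [Nat.sub_add_cancel (show l ≤ x by omega),
      Nat.add_sub_cancel' (show l ≤ y by omega)]
  · intros; rfl

theorem sum_C_eq (n : ℕ) (hn : 2 ≤ n) :
    (∑ v ∈ (Finset.Icc 1 n ×ˢ Finset.Icc 1 n ×ˢ Finset.Icc 1 n ×ˢ Finset.Icc 1 n ×ˢ
        Finset.Icc 1 n).filter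
        (fun v : ℕ × ℕ × ℕ × ℕ × ℕ => Nat.gcd v.1 v.2.1 = 1 ∧
          v.1 * (v.2.2.1 + v.2.2.2.1) + v.2.1 * (v.2.2.2.1 + v.2.2.2.2) = n),
      ((v.2.2.1 + v.2.2.2.1) * (v.2.2.2.1 + v.2.2.2.2) *
        Nat.totient (Nat.gcd (v.2.2.1 + v.2.2.2.1) (v.2.2.2.1 + v.2.2.2.2)) : ℚ) /
        (Nat.gcd (v.2.2.1 + v.2.2.2.1) (v.2.2.2.1 + v.2.2.2.2) : ℚ))
    = (1 / 12) * ((n : ℚ) - 2) * ((n : ℚ) - 3) * jordanTotient 2 n := by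
  have hn' : n ≠ 0 := by omega
  have hn0 : (n : ℚ) ≠ 0 := by exact_mod_cast hn'
  let w : ℕ → ℚ := fun g => (g.totient : ℚ) / g
  let f : ℕ → ℕ → ℚ := fun x y =>
    ((x : ℚ) * y * (x + y) - (x ^ 2 + x * y + y ^ 2)) / 2 * w (x.gcd y)
  let F : ℕ → ℕ → ℚ := fun x y => (((min x y : ℕ) : ℚ) - 1) * ((x : ℚ) * y * w (x.gcd y))
  have hquint := sum_filter_quintuples_eq n fun x y => (x : ℚ) * y * w (x.gcd y)
  have hrep := sum_coprimeRepresentations_eq n F f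
    (fun x y => by simp only [F, Nat.gcd_comm y x, min_comm y x]; ring)
    (fun x y => by simp only [f, Nat.gcd_comm y x]; ring)
    (fun x y hxy => by
      simp only [F, f, min_eq_right hxy.le, Nat.gcd_sub_self_left hxy.le, Nat.cast_sub hxy.le]
      ring)
  have hone : ∑ x ∈ Finset.Ico 1 n, f x (n - x) = ∑ x ∈ Finset.Ico 1 n,
      ((n + 1) / 2 * ((x : ℚ) * (n - x) * w (x.gcd n)) - n ^ 2 / 2 * w (x.gcd n)) := by
    refine Finset.sum_congr rfl fun x hx => ?_
    have hxn : x ≤ n := (Finset.mem_Ico.1 hx).2.le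
    have hg : x.gcd (n - x) = x.gcd n := by
      conv_rhs => rw [← Nat.sub_add_cancel hxn, Nat.gcd_add_self_right]
    simp only [f, hg, Nat.cast_sub hxn]
    ring
  have hdiag (x : ℕ) : F x x - f x x = (x : ℚ) * x.totient / 2 := by
    rcases eq_or_ne x 0 with rfl | hx
    · simp [F, f]
    have hx0 : (x : ℚ) ≠ 0 := by exact_mod_cast hx
    simp only [F, f, w, min_self, Nat.gcd_self]
    field_simp
    ring
  simp only [hdiag] at hrep
  rw [sum_filter_fst_eq_snd, sum_filter_coeff_eq n fun x => (x : ℚ) * x.totient / 2, hone] at hrep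
  have htop (g : ℕ → ℚ) : ∑ x ∈ Finset.Ico 1 n, g x = ∑ x ∈ Finset.Icc 1 n, g x - g n := by
    rw [← Finset.sum_Ico_add_eq_sum_Icc (by omega), add_sub_cancel_right]
  have hw := sum_Icc_totient_gcd_div_gcd hn'
  have hxw := sum_Icc_mul_sub_mul_totient_gcd_div_gcd hn
  have hgw := sum_Icc_gcd_mul_totient_gcd hn'
  calc _ = ∑ v ∈ coprimeRepresentations n, F v.2.2.1 v.2.2.2 := by
        rw [← hquint]
        refine Finset.sum_congr rfl fun v _ => ?_
        simp only [w]
        push_cast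
        ring
    _ = _ := by
        rw [hrep, htop, htop, Finset.sum_sub_distrib, ← Finset.mul_sum, ← Finset.mul_sum,
          ← Finset.sum_div, hgw]
        simp only [w]
        rw [hw, hxw, Nat.gcd_self]
        field_simp
        ring
end
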